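/- arXiv:1402.4780 — 5 statements merged into one kernel-verified Lean document; each statement's English description precedes it below -/
import Mathlib

section
/- Fix a real number c. Then, as T → ∞, ∫_0^T (T − t)·log|c + it| dt = (1/2)·T²·log T − (3/4)·T² + (π|c|/2)·T + O(log T + 1); that is, there exist constants C > 0 and T₀ ≥ 2 (depending on c) such that the absolute difference between the integral and (1/2)T²log T − (3/4)T² + (π|c|/2)T is at most C·log T for all T ≥ T₀. -/
open Complex

lemma aux_norm (c t : ℝ) : Real.log ‖(c : ℂ) + t * Complex.I‖ = Real.log (|c|^2 + t^2) / 2 := by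
  rw [Complex.norm_add_mul_I, Real.log_sqrt (by positivity), sq_abs]

lemma aux_zero (T : ℝ) (hT : 0 < T) :
    ∫ t in (0:ℝ)..T, (T - t) * Real.log t = (1/2) * T^2 * Real.log T - (3/4) * T^2 := by
  rw [intervalIntegral.integral_eq_sub_of_hasDerivAt_of_le hT.le
    (f := fun t => T * (t * Real.log t - t) - (t / 2 * (t * Real.log t) - t^2/4))]
  · simp; ring
  · have := Real.continuous_mul_log
    fun_prop
  · intro t ht
    have h := Real.hasDerivAt_mul_log ht.1.ne'
    have h2 := ((h.sub (hasDerivAt_id t)).const_mul T).sub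
      ((((hasDerivAt_id t).div_const 2).mul h).sub (((hasDerivAt_id t).pow 2).div_const 4))
    refine HasDerivAt.congr_deriv h2 ?_
    simp; ring
  · exact intervalIntegral.intervalIntegrable_log'.continuousOn_mul (by fun_prop)

lemma aux_pos (a T : ℝ) (ha : 0 < a) :
    ∫ t in (0:ℝ)..T, (T - t) * (Real.log (a^2 + t^2) / 2)
      = T * (T * (Real.log (a^2 + T^2) / 2) - T + a * Real.arctan (T / a))
        - ((a^2 + T^2) / 2 * (Real.log (a^2 + T^2) / 2) - T^2/4) + a^2 / 2 * Real.log a := by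
  have hp : ∀ t : ℝ, a^2 + t^2 ≠ 0 := fun t => by positivity
  rw [intervalIntegral.integral_eq_sub_of_hasDerivAt
    (f := fun t => T * (t * (Real.log (a^2 + t^2) / 2) - t + a * Real.arctan (t / a))
        - ((a^2 + t^2) / 2 * (Real.log (a^2 + t^2) / 2) - t^2/4))]
  · simp
  · intro t _
    have hq : HasDerivAt (fun t : ℝ => a^2 + t^2) (2 * t) t := by
      simpa using ((hasDerivAt_id t).pow 2).const_add (a^2)
    have hL := (hq.log (hp t)).div_const 2
    have hA := (((hasDerivAt_id t).div_const a).arctan).const_mul a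
    have h2 := (((((hasDerivAt_id t).mul hL).sub (hasDerivAt_id t)).add hA).const_mul T).sub
      (((hq.div_const 2).mul hL).sub (((hasDerivAt_id t).pow 2).div_const 4))
    refine HasDerivAt.congr_deriv h2 ?_
    have := hp t
    have h3 : 1 + (t / a)^2 = (a^2 + t^2) / a^2 := by field_simp
    simp [h3]
    field_simp
    ring
  · apply Continuous.intervalIntegrable
    have : Continuous fun t : ℝ => Real.log (a^2 + t^2) :=
      Continuous.log (by fun_prop) hp
    fun_prop

theorem aux_main (a T : ℝ) (ha : 0 < a) (hT : 3 ≤ T) :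
    |(T * (T * (Real.log (a^2 + T^2) / 2) - T + a * Real.arctan (T / a))
        - ((a^2 + T^2) / 2 * (Real.log (a^2 + T^2) / 2) - T^2/4) + a^2 / 2 * Real.log a)
      - ((1/2) * T^2 * Real.log T - (3/4) * T^2 + (Real.pi * a / 2) * T)|
     ≤ (a^2 / 4 + a^2 + a^2 / 2 * (1 + a^2 + |Real.log a|) + 1) * Real.log T := by
  have hT0 : 0 < T := by linarith
  have hlog : 1 ≤ Real.log T := by
    rw [Real.le_log_iff_exp_le hT0]
    linarith [Real.exp_one_lt_d9]
  obtain ⟨u, hu⟩ : ∃ u, u = Real.log (a^2 + T^2) / 2 - Real.log T := ⟨_, rfl⟩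
  have hu' : u = Real.log (1 + a^2 / T^2) / 2 := by
    have : 1 + a^2/T^2 = (a^2 + T^2) / T^2 := by field_simp; ring
    rw [hu, this, Real.log_div (by positivity) (by positivity), Real.log_pow]
    push_cast; ring
  have hu0 : 0 ≤ u := by
    rw [hu']
    have : 0 ≤ Real.log (1 + a^2 / T^2) := Real.log_nonneg (by
      have : 0 ≤ a^2/T^2 := by positivity
      linarith)
    linarith
  have hu1 : T^2 * u ≤ a^2 / 2 := by
    have h1 : Real.log (1 + a^2 / T^2) ≤ a^2 / T^2 := by
      have := Real.log_le_sub_one_of_pos (x := 1 + a^2 / T^2) (by positivity)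
      linarith
    have h2 : T^2 * (a^2 / T^2) = a^2 := by field_simp
    have := mul_le_mul_of_nonneg_left h1 (sq_nonneg T)
    rw [hu']; linarith
  have hu2 : u ≤ a^2 := by
    have : 1 * u ≤ T^2 * u := mul_le_mul_of_nonneg_right (by nlinarith) hu0
    linarith [sq_nonneg a]
  have harc : Real.arctan (T / a) = Real.pi / 2 - Real.arctan (a / T) := by
    rw [← Real.arctan_inv_of_pos (by positivity), inv_div]
  obtain ⟨v, hv⟩ : ∃ v, v = Real.arctan (a / T) := ⟨_, rfl⟩
  have hv0 : 0 ≤ v := by rw [hv]; exact Real.arctan_nonneg.2 (by positivity)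
  have hv1 : T * v ≤ a := by
    have : v ≤ a / T := by
      have h := Real.le_tan hv0 (by rw [hv]; exact Real.arctan_lt_pi_div_two _)
      rwa [hv, Real.tan_arctan, ← hv] at h
    rw [le_div_iff₀ hT0] at this; linarith
  have hL : Real.log (a^2 + T^2) / 2 = Real.log T + u := by rw [hu]; ring
  rw [harc, ← hv, hL]
  have e : (T * (T * (Real.log T + u) - T + a * (Real.pi / 2 - v))
        - ((a^2 + T^2) / 2 * (Real.log T + u) - T^2/4) + a^2 / 2 * Real.log a)
      - ((1/2) * T^2 * Real.log T - (3/4) * T^2 + (Real.pi * a / 2) * T)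
      = T^2 * u / 2 - a * (T * v) - a^2 / 2 * (Real.log T + u - Real.log a) := by ring
  rw [e]
  have b1 : |T^2 * u / 2| ≤ a^2/4 := by
    rw [abs_of_nonneg (by positivity)]; linarith
  have b2 : |a * (T * v)| ≤ a^2 := by
    rw [abs_of_nonneg (by positivity)]; nlinarith
  have b3 : |a^2 / 2 * (Real.log T + u - Real.log a)|
      ≤ a^2/2 * (Real.log T + a^2 + |Real.log a|) := by
    rw [abs_mul, abs_of_nonneg (by positivity : 0 ≤ a^2/2)]
    gcongr
    rw [abs_le]
    constructor <;> linarith [neg_abs_le (Real.log a), le_abs_self (Real.log a), sq_nonneg a]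
  have b4 : a^2 / 4 + a^2 + a^2/2 * (a^2 + |Real.log a|)
      ≤ (a^2 / 4 + a^2 + a^2/2 * (a^2 + |Real.log a|)) * Real.log T :=
    le_mul_of_one_le_right (by positivity) hlog
  have t1 := abs_sub (T^2 * u / 2 - a * (T * v)) (a^2 / 2 * (Real.log T + u - Real.log a))
  have t2 := abs_sub (T^2 * u / 2) (a * (T * v))
  linarith

/-- For a fixed real `c`, as `T → ∞`,
`∫_0^T (T-t)·log|c+it| dt = ½T²log T - ¾T² + (π|c|/2)T + O(log T)`. -/
theorem integral_smoothed_log_abs_linear (c : ℝ) :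
    ∃ C T₀ : ℝ, 0 < C ∧ 2 ≤ T₀ ∧ ∀ T : ℝ, T₀ ≤ T →
      |(∫ t in (0:ℝ)..T, (T - t) * Real.log ‖(c : ℂ) + t * Complex.I‖)
          - ((1/2) * T^2 * Real.log T - (3/4) * T^2 + (Real.pi * |c| / 2) * T)|
        ≤ C * Real.log T := by
  simp only [aux_norm]
  rcases eq_or_ne c 0 with rfl | hc
  · refine ⟨1, 3, by norm_num, by norm_num, fun T hT => ?_⟩
    have h : ∀ t : ℝ, Real.log (|(0:ℝ)|^2 + t^2) / 2 = Real.log t := fun t => by simp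
    simp only [h]
    rw [aux_zero T (by linarith)]
    simp
    exact Real.log_nonneg (by linarith)
  · have ha : 0 < |c| := abs_pos.2 hc
    refine ⟨|c|^2 / 4 + |c|^2 + |c|^2 / 2 * (1 + |c|^2 + |Real.log (|c|)|) + 1, 3, by positivity,
      by norm_num, fun T hT => ?_⟩
    rw [aux_pos _ T ha]
    exact aux_main _ T ha hT
end

section
/- As T → ∞, ∫_0^T (T − t)·log( t·tanh(πt)/π ) dt = (1/2)·T²·log T − ( 3/4 + (1/2)·log π )·T² − (π/8)·T + O(1); that is, there exist constants C > 0 and T₀ ≥ 2 such that the absolute difference between the integral and (1/2)T²log T − (3/4 + (log π)/2)T² − (π/8)T is at most C for all T ≥ T₀. -/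
open MeasureTheory Set

noncomputable def gAux (t : ℝ) : ℝ := -Real.log (Real.tanh (Real.pi * t))

lemma gAux_hasSum {t : ℝ} (ht : 0 < t) :
    HasSum (fun k : ℕ => 2 / (2 * (k:ℝ) + 1) * Real.exp (-(2 * Real.pi * (2 * k + 1)) * t)) (gAux t) := by
  have hp := Real.pi_pos
  set q := Real.exp (-(2 * Real.pi * t)) with hq
  have q0 : 0 < q := Real.exp_pos _
  have q1 : q < 1 := by
    rw [hq, Real.exp_lt_one_iff]
    have := mul_pos hp ht
    linarith
  have h := Real.hasSum_log_sub_log_of_abs_lt_one (x := q) (by rw [abs_of_pos q0]; exact q1)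
  convert h using 1
  · funext k
    rw [hq, ← Real.exp_nat_mul]
    push_cast
    ring_nf
  · rw [gAux, ← Real.log_div (by linarith) (by linarith), ← Real.log_inv]
    congr 1
    rw [Real.tanh_eq_sinh_div_cosh, inv_div, Real.cosh_eq, Real.sinh_eq]
    have e1 : q = Real.exp (-(Real.pi * t)) * Real.exp (-(Real.pi * t)) := by
      rw [hq, ← Real.exp_add]; ring_nf
    have e2 : Real.exp (Real.pi * t) * Real.exp (-(Real.pi * t)) = 1 := by
      rw [← Real.exp_add]; simp
    have e3 : Real.exp (-(Real.pi * t)) < Real.exp (Real.pi * t) := by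
      apply Real.exp_lt_exp.2
      have := mul_pos hp ht
      linarith
    have e4 := Real.exp_pos (-(Real.pi * t))
    rw [div_eq_div_iff (by linarith) (by linarith), e1]
    generalize Real.exp (-(Real.pi * t)) = a at *
    generalize Real.exp (Real.pi * t) = b at *
    linear_combination - (a : ℝ) * e2

lemma gAux_nonneg {t : ℝ} (ht : 0 < t) : 0 ≤ gAux t :=
  (gAux_hasSum ht).nonneg fun k => by positivity

lemma hasSum_odd_sq : HasSum (fun k : ℕ => 1 / (2 * (k:ℝ) + 1) ^ 2) (Real.pi ^ 2 / 8) := by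
  have h := hasSum_zeta_two
  have he : HasSum (fun k : ℕ => 1 / ((2 * k : ℕ) : ℝ) ^ 2) (1 / 4 * (Real.pi ^ 2 / 6)) := by
    have h4 := h.mul_left (1/4 : ℝ)
    have hfun : (fun k : ℕ => 1 / ((2 * k : ℕ) : ℝ) ^ 2) = fun k : ℕ => 1/4 * (1 / (k : ℝ) ^ 2) := ?_
    · rw [hfun]; exact h4
    funext k
    push_cast
    rw [mul_pow, one_div, one_div, mul_inv]; norm_num
  have hs : Summable (fun k : ℕ => 1 / ((2 * k + 1 : ℕ) : ℝ) ^ 2) :=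
    h.summable.comp_injective (i := fun k : ℕ => 2 * k + 1) (fun a b hab => by simpa using hab)
  have := (HasSum.even_add_odd (f := fun n : ℕ => 1 / (n:ℝ) ^ 2) he hs.hasSum).unique h
  have h2 := hs.hasSum
  rw [show (∑' k : ℕ, 1 / ((2 * k + 1 : ℕ) : ℝ) ^ 2) = Real.pi ^ 2 / 8 by linarith] at h2
  simpa using h2

lemma gAux_integral : ∫ t in Ioi (0:ℝ), gAux t = Real.pi / 8 := by
  have hp := Real.pi_pos
  have hneg : ∀ k : ℕ, -(2 * Real.pi * (2 * (k:ℝ) + 1)) < 0 := fun k => by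
    have : 0 < 2 * Real.pi * (2 * (k:ℝ) + 1) := by positivity
    linarith
  have hval : ∀ k : ℕ, ∫ t in Ioi (0:ℝ), 2 / (2 * (k:ℝ) + 1) *
      Real.exp (-(2 * Real.pi * (2 * k + 1)) * t) = 1 / Real.pi * (1 / (2 * (k:ℝ) + 1) ^ 2) := by
    intro k
    rw [integral_const_mul, integral_exp_mul_Ioi (hneg k)]
    have : (2 * (k:ℝ) + 1) ≠ 0 := by positivity
    simp
    field_simp
  have hsum := hasSum_odd_sq.mul_left (1 / Real.pi)
  have h := hasSum_integral_of_summable_integral_norm (μ := volume.restrict (Ioi (0:ℝ)))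
    (F := fun (k : ℕ) t => 2 / (2 * (k:ℝ) + 1) * Real.exp (-(2 * Real.pi * (2 * k + 1)) * t))
    (fun k => (integrableOn_exp_mul_Ioi (hneg k) 0).const_mul _)
    (by
      refine hsum.summable.congr fun k => ?_
      rw [← hval k]
      congr 1
      funext t
      rw [Real.norm_of_nonneg (by positivity)])
  simp_rw [hval] at h
  have h2 := h.unique hsum
  rw [setIntegral_congr_fun (g := gAux) measurableSet_Ioi
    (fun t ht => (gAux_hasSum ht).tsum_eq)] at h2
  rw [h2]; field_simp

lemma gAux_int : IntegrableOn gAux (Ioi 0) := by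
  by_contra h
  have := integral_undef h
  rw [gAux_integral] at this
  have := Real.pi_pos
  linarith

lemma gAux_half {t : ℝ} (ht : 0 < t) : t * gAux t ≤ gAux (1/2 * t) := by
  refine hasSum_le (fun k => ?_) ((gAux_hasSum ht).mul_left t) (gAux_hasSum (t := 1/2 * t) (by positivity))
  have hp := Real.pi_gt_three
  have h1 : t ≤ Real.exp (Real.pi * (2 * k + 1) * t) := by
    have h2 := Real.add_one_le_exp (Real.pi * (2 * k + 1) * t)
    have h3 : 1 * t ≤ Real.pi * (2 * k + 1) * t := by
      apply mul_le_mul_of_nonneg_right _ ht.le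
      have : (0:ℝ) ≤ k := by positivity
      nlinarith
    linarith
  have h4 : Real.exp (-(2 * Real.pi * (2 * k + 1)) * (1/2 * t)) =
      Real.exp (Real.pi * (2 * k + 1) * t) * Real.exp (-(2 * Real.pi * (2 * k + 1)) * t) := by
    rw [← Real.exp_add]; ring_nf
  rw [h4]
  have h5 : 0 ≤ 2 / (2 * (k:ℝ) + 1) * Real.exp (-(2 * Real.pi * (2 * k + 1)) * t) := by positivity
  nlinarith [mul_le_mul_of_nonneg_right h1 h5]

lemma tgAux_int : IntegrableOn (fun t => t * gAux t) (Ioi 0) := by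
  have h : IntegrableOn (fun t => gAux (1/2 * t)) (Ioi 0) := by
    rw [integrableOn_Ioi_comp_mul_left_iff gAux 0 (by norm_num : (0:ℝ) < 1/2)]
    simpa using gAux_int
  refine Integrable.mono' h (continuous_id.aestronglyMeasurable.mul gAux_int.1) ?_
  filter_upwards [ae_restrict_mem measurableSet_Ioi] with t ht
  rw [Real.norm_of_nonneg (mul_nonneg (le_of_lt ht) (gAux_nonneg ht))]
  exact gAux_half ht

lemma logpart_int (T : ℝ) :
    IntervalIntegrable (fun t => (T - t) * (Real.log t - Real.log Real.pi)) volume 0 T := by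
  refine IntervalIntegrable.continuousOn_mul ?_ (by fun_prop)
  exact intervalIntegral.intervalIntegrable_log'.sub intervalIntegrable_const

lemma logpart (T : ℝ) (hT : 0 < T) :
    ∫ t in (0:ℝ)..T, (T - t) * (Real.log t - Real.log Real.pi) =
      (1/2) * T^2 * Real.log T - (3/4 + Real.log Real.pi / 2) * T^2 := by
  have hc := Real.continuous_mul_log
  rw [intervalIntegral.integral_eq_sub_of_hasDeriv_right_of_le
    (f := fun t => T * (t * Real.log t - t) - (1/2 * (t * (t * Real.log t)) - t^2/4)
      - Real.log Real.pi * (T * t - t^2/2)) hT.le (by fun_prop) ?_ (logpart_int T)]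
  · simp; ring
  · intro x hx
    have hx0 : x ≠ 0 := hx.1.ne'
    have h1 := Real.hasDerivAt_mul_log hx0
    have hid := hasDerivAt_id x
    have h2 := hid.pow 2
    have := ((((h1.sub hid).const_mul T).sub (((hid.mul h1).const_mul (1/2)).sub (h2.div_const 4))).sub
      (((hid.const_mul T).sub (h2.div_const 2)).const_mul (Real.log Real.pi)))
    refine HasDerivAt.hasDerivWithinAt ?_
    refine HasDerivAt.congr_deriv this ?_
    simp
    ring

/-- As `T → ∞`,
`∫_0^T (T-t)·log(t·tanh(πt)/π) dt = ½T²log T - (¾ + ½log π)T² - (π/8)T + O(1)`. -/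
theorem integral_smoothed_log_tanh :
    ∃ C T₀ : ℝ, 0 < C ∧ 2 ≤ T₀ ∧ ∀ T : ℝ, T₀ ≤ T →
      |(∫ t in (0:ℝ)..T, (T - t) * Real.log (t * Real.tanh (Real.pi * t) / Real.pi))
          - ((1/2) * T^2 * Real.log T - (3/4 + Real.log Real.pi / 2) * T^2
              - (Real.pi/8) * T)|
        ≤ C := by
  have hp := Real.pi_pos
  have hC : 0 ≤ ∫ t in Ioi (0:ℝ), t * gAux t :=
    setIntegral_nonneg measurableSet_Ioi fun t ht => mul_nonneg (le_of_lt ht) (gAux_nonneg ht)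
  refine ⟨(∫ t in Ioi (0:ℝ), t * gAux t) + 1, 2, by linarith, le_rfl, fun T hT => ?_⟩
  have hT0 : 0 < T := by linarith
  have hsub : Ioc 0 T ⊆ Ioi (0:ℝ) := Ioc_subset_Ioi_self
  have hsub2 : Ioi T ⊆ Ioi (0:ℝ) := Ioi_subset_Ioi hT0.le
  have i1 : IntervalIntegrable gAux volume 0 T :=
    (intervalIntegrable_iff_integrableOn_Ioc_of_le hT0.le).2 (gAux_int.mono_set hsub)
  have i2 : IntervalIntegrable (fun t => t * gAux t) volume 0 T :=
    (intervalIntegrable_iff_integrableOn_Ioc_of_le hT0.le).2 (tgAux_int.mono_set hsub)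
  have e1 : (∫ t in (0:ℝ)..T, (T - t) * Real.log (t * Real.tanh (Real.pi * t) / Real.pi)) =
      ∫ t in (0:ℝ)..T, ((T - t) * (Real.log t - Real.log Real.pi) - (T * gAux t - t * gAux t)) := by
    rw [intervalIntegral.integral_of_le hT0.le, intervalIntegral.integral_of_le hT0.le]
    refine setIntegral_congr_fun measurableSet_Ioc fun t ht => ?_
    have ht0 : t ≠ 0 := ht.1.ne'
    have hth : Real.tanh (Real.pi * t) ≠ 0 := by
      rw [Real.tanh_eq_sinh_div_cosh]
      exact (div_pos (Real.sinh_pos_iff.2 (mul_pos hp ht.1)) (Real.cosh_pos _)).ne'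
    simp only [gAux]
    rw [Real.log_div (mul_ne_zero ht0 hth) hp.ne', Real.log_mul ht0 hth]
    ring
  rw [e1, intervalIntegral.integral_sub (logpart_int T) ((i1.const_mul T).sub i2),
    intervalIntegral.integral_sub (i1.const_mul T) i2, intervalIntegral.integral_const_mul,
    logpart T hT0, intervalIntegral.integral_of_le hT0.le, intervalIntegral.integral_of_le hT0.le]
  have s1 := setIntegral_union (Ioc_disjoint_Ioi le_rfl) measurableSet_Ioi
    (gAux_int.mono_set hsub) (gAux_int.mono_set hsub2)
  have s2 := setIntegral_union (Ioc_disjoint_Ioi le_rfl) measurableSet_Ioi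
    (tgAux_int.mono_set hsub) (tgAux_int.mono_set hsub2)
  rw [Ioc_union_Ioi_eq_Ioi hT0.le] at s1 s2
  rw [gAux_integral] at s1
  have b1 : 0 ≤ ∫ t in Ioi T, gAux t :=
    setIntegral_nonneg measurableSet_Ioi fun t ht => gAux_nonneg (hsub2 ht)
  have b2 : 0 ≤ ∫ t in Ioc 0 T, t * gAux t :=
    setIntegral_nonneg measurableSet_Ioc fun t ht => mul_nonneg ht.1.le (gAux_nonneg ht.1)
  have b3 : T * ∫ t in Ioi T, gAux t ≤ ∫ t in Ioi T, t * gAux t := by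
    rw [← integral_const_mul]
    refine setIntegral_mono_on ((gAux_int.mono_set hsub2).const_mul T) (tgAux_int.mono_set hsub2)
      measurableSet_Ioi fun t ht => ?_
    exact mul_le_mul_of_nonneg_right (le_of_lt ht) (gAux_nonneg (hsub2 ht))
  have b4 := mul_nonneg hT0.le b1
  rw [s1, s2, abs_le]
  constructor <;> linarith
end

section
/- Let ℓ > 0. The infinite product Z(s) = ∏_{a=0}^∞ ( 1 − e^{−(s+a)ℓ} ) converges locally uniformly on ℂ and defines an entire function. Its zero set is exactly { −a + 2πib/ℓ : a ∈ ℤ, a ≥ 0, b ∈ ℤ }, and every zero of Z is simple (has order one). -/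
open Complex Filter

lemma zp_norm (ℓ : ℝ) (n : ℕ) (s : ℂ) :
    ‖-Complex.exp (-(s + n) * ℓ)‖ = Real.exp (-s.re * ℓ) * Real.exp (-ℓ) ^ n := by
  rw [norm_neg, Complex.norm_exp, ← Real.exp_nat_mul, ← Real.exp_add]
  congr 1
  simp
  ring

lemma zp_geom (ℓ : ℝ) (hℓ : 0 < ℓ) (C : ℝ) : Summable fun n : ℕ => C * Real.exp (-ℓ) ^ n :=
  (summable_geometric_of_lt_one (Real.exp_pos _).le (by simpa using hℓ)).mul_left C

lemma zp_tendsto (ℓ : ℝ) (hℓ : 0 < ℓ) :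
    TendstoLocallyUniformly
        (fun N : ℕ => fun s : ℂ =>
          ∏ a ∈ Finset.range N, (1 - Complex.exp (-(s + a) * ℓ)))
        (fun s => ∏' a : ℕ, (1 + -Complex.exp (-(s + a) * ℓ))) atTop := by
  have key : ∀ R : ℝ, TendstoLocallyUniformlyOn (fun N : ℕ => fun s : ℂ =>
          ∏ a ∈ Finset.range N, (1 - Complex.exp (-(s + a) * ℓ)))
        (fun s => ∏' a : ℕ, (1 + -Complex.exp (-(s + a) * ℓ))) atTop {s : ℂ | -R < s.re} := by
    intro R
    have h := Summable.hasProdLocallyUniformlyOn_nat_one_add (K := {s : ℂ | -R < s.re})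
      (f := fun (n : ℕ) (s : ℂ) => -Complex.exp (-(s + n) * ℓ))
      (isOpen_lt continuous_const Complex.continuous_re)
      (zp_geom ℓ hℓ (Real.exp (R * ℓ)))
      (Eventually.of_forall fun n s hs => by
        rw [zp_norm]
        have hs' : -R < s.re := hs
        gcongr
        linarith)
      (fun n => by fun_prop)
    simpa only [← sub_eq_add_neg] using h.tendstoLocallyUniformlyOn_finsetRange
  intro v hv s
  have hs : s ∈ {z : ℂ | -(-s.re + 1) < z.re} := by
    simp only [Set.mem_setOf_eq]; linarith
  obtain ⟨t, ht, h⟩ := key (-s.re + 1) v hv s hs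
  rw [(isOpen_lt continuous_const Complex.continuous_re).nhdsWithin_eq hs] at ht
  exact ⟨t, ht, h⟩

/-- the statement -/
theorem zp_factor (ℓ : ℝ) (Z : ℂ → ℂ)
    (hZ : ∀ s : ℂ, Tendsto (fun N : ℕ => ∏ a ∈ Finset.range N, (1 - Complex.exp (-(s + a) * ℓ)))
      atTop (nhds (Z s))) (k : ℕ) (s : ℂ) :
    Z s = (∏ a ∈ Finset.range k, (1 - Complex.exp (-(s + a) * ℓ))) * Z (s + k) := by
  have h1 := (hZ s).comp (tendsto_add_atTop_nat k)
  have h2 := (hZ (s + k)).const_mul (∏ a ∈ Finset.range k, (1 - Complex.exp (-(s + a) * ℓ)))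
  refine tendsto_nhds_unique h1 (h2.congr fun N => ?_)
  simp only [Function.comp]
  rw [add_comm N k, Finset.prod_range_add]
  congr 1
  refine Finset.prod_congr rfl fun i _ => ?_
  push_cast
  ring_nf

/-- For `ℓ > 0`, the product `Z(s) = ∏_{a=0}^∞ (1 - e^{-(s+a)ℓ})`
converges locally uniformly on `ℂ` to an entire function whose zero set is exactly
`{-a + 2πib/ℓ : a,b ∈ ℤ, a ≥ 0}`, all zeroes being simple. -/
theorem zeta_product_entire_zero_set (ℓ : ℝ) (hℓ : 0 < ℓ) :
    ∃ Z : ℂ → ℂ,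
      TendstoLocallyUniformly
        (fun N : ℕ => fun s : ℂ =>
          ∏ a ∈ Finset.range N, (1 - Complex.exp (-(s + a) * ℓ))) Z atTop ∧
      Differentiable ℂ Z ∧
      (∀ s : ℂ, Z s = 0 ↔
        ∃ a b : ℤ, 0 ≤ a ∧ s = -(a : ℂ) + 2 * Real.pi * Complex.I * b / ℓ) ∧
      (∀ s : ℂ, Z s = 0 → deriv Z s ≠ 0) := by
  have hT := zp_tendsto ℓ hℓ
  have hne : ∀ s : ℂ, (∀ n : ℕ, 1 - Complex.exp (-(s + n) * ℓ) ≠ 0) →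
      (fun s : ℂ => ∏' a : ℕ, (1 + -Complex.exp (-(s + a) * ℓ))) s ≠ 0 := by
    intro s h
    refine tprod_one_add_ne_zero_of_summable (by simpa only [← sub_eq_add_neg] using h) ?_
    simp only [zp_norm]
    exact zp_geom ℓ hℓ _
  generalize (fun s : ℂ => ∏' a : ℕ, (1 + -Complex.exp (-(s + a) * ℓ))) = Z at hT hne
  have hD : Differentiable ℂ Z := by
    rw [← differentiableOn_univ]
    refine (tendstoLocallyUniformlyOn_univ.mpr hT).differentiableOn
      (Eventually.of_forall fun N => ?_) isOpen_univ
    fun_prop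
  have hP : ∀ s : ℂ, Tendsto (fun N : ℕ => ∏ a ∈ Finset.range N,
      (1 - Complex.exp (-(s + a) * ℓ))) atTop (nhds (Z s)) := fun s =>
    (tendstoLocallyUniformlyOn_univ.mpr hT).tendsto_at (Set.mem_univ s)
  have hF := zp_factor ℓ Z hP
  have hz : ∀ s : ℂ, Z s = 0 ↔ ∃ n : ℕ, 1 - Complex.exp (-(s + n) * ℓ) = 0 := by
    intro s
    constructor
    · intro h
      by_contra! hc
      exact hne s hc h
    · rintro ⟨n, hn⟩
      rw [hF (n + 1) s, Finset.prod_range_succ, hn]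
      simp
  have hre : ∀ (s : ℂ) (n : ℕ), 1 - Complex.exp (-(s + n) * ℓ) = 0 → s.re = -n := by
    intro s n h
    have h1 := zp_norm ℓ n s
    rw [← sub_eq_zero.mp h, norm_neg, norm_one, ← Real.exp_nat_mul, ← Real.exp_add] at h1
    have h2 := (Real.exp_eq_one_iff _).mp h1.symm
    have h3 : (s.re + n) * ℓ = 0 := by linarith
    have := (mul_eq_zero.mp h3).resolve_right hℓ.ne'
    linarith
  have hl : (ℓ : ℂ) ≠ 0 := by exact_mod_cast hℓ.ne'
  refine ⟨Z, hT, hD, fun s => ?_, fun s hs => ?_⟩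
  · rw [hz]
    constructor
    · rintro ⟨n, hn⟩
      obtain ⟨b, hb⟩ := Complex.exp_eq_one_iff.mp (sub_eq_zero.mp hn).symm
      refine ⟨n, -b, by positivity, ?_⟩
      field_simp
      push_cast
      linear_combination -hb
    · rintro ⟨a, b, ha, rfl⟩
      lift a to ℕ using ha
      refine ⟨a, ?_⟩
      rw [sub_eq_zero, eq_comm, Complex.exp_eq_one_iff]
      refine ⟨-b, ?_⟩
      push_cast
      field_simp
      ring
  · obtain ⟨n, hn⟩ := (hz s).mp hs
    have hr := hre s n hn
    have e : Z = fun s => (1 - Complex.exp (-(s + n) * ℓ)) *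
        ((∏ a ∈ Finset.range n, (1 - Complex.exp (-(s + a) * ℓ))) * Z (s + (n + 1 : ℕ))) := by
      funext w
      rw [hF (n + 1) w, Finset.prod_range_succ]
      ring
    have h1 : HasDerivAt (fun s : ℂ => 1 - Complex.exp (-(s + n) * ℓ)) ℓ s := by
      have := ((((hasDerivAt_id s).add_const (n : ℂ)).neg.mul_const (ℓ : ℂ)).cexp).const_sub 1
      simp only [Pi.neg_apply, id] at this
      rw [← sub_eq_zero.mp hn] at this
      simpa using this
    have h2 : DifferentiableAt ℂ (fun s : ℂ => (∏ a ∈ Finset.range n,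
        (1 - Complex.exp (-(s + a) * ℓ))) * Z (s + (n + 1 : ℕ))) s := by
      fun_prop
    have h3 := (h1.mul h2.hasDerivAt).deriv
    rw [e]
    refine ne_of_eq_of_ne h3 ?_
    rw [hn, zero_mul, add_zero]
    refine mul_ne_zero hl (mul_ne_zero ?_ ?_)
    · refine Finset.prod_ne_zero_iff.mpr fun a ha h => ?_
      have := hre s a h
      have h4 : (a : ℝ) = n := by linarith
      have h5 : a = n := by exact_mod_cast h4
      simp [h5] at ha
    · rw [Ne, hz]
      rintro ⟨m, hm⟩
      have := hre _ m hm
      simp [hr] at this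
      have : (0 : ℝ) ≤ m := by positivity
      linarith
end

section
/- There exists a constant C > 0 such that for every σ with 0 ≤ σ ≤ 1 and every real t with |t| ≥ 3, |f(σ + it)| ≤ C·|t|^{r(1−σ)}·log|t| (the convexity bound for f, obtained by Phragmén–Lindelöf interpolation between the lines Re(s) = 0 and Re(s) = 1 + 1/log|t|). -/
open Filter Complex

theorem dcb_rect (f : ℂ → ℂ) (r b L h T M : ℝ) (hb : 0 < b) (hh : 0 < h)
    (hd : DifferentiableOn ℂ f (Set.Ioo 0 b ×ℂ Set.Ioo (T - h) (T + h)))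
    (hc : ContinuousOn f (Set.Icc 0 b ×ℂ Set.Icc (T - h) (T + h)))
    (hleft : ∀ t ∈ Set.Icc (T - h) (T + h), ‖f (((0:ℝ):ℂ) + t * I)‖ *
      Real.exp (r * L * (0 - b) + 0 ^ 2 - (t - T) ^ 2) ≤ M)
    (hright : ∀ t ∈ Set.Icc (T - h) (T + h), ‖f ((b:ℂ) + t * I)‖ *
      Real.exp (r * L * (b - b) + b ^ 2 - (t - T) ^ 2) ≤ M)
    (hhor : ∀ σ ∈ Set.Icc 0 b, ∀ t, (t = T - h ∨ t = T + h) → ‖f ((σ:ℂ) + t * I)‖ *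
      Real.exp (r * L * (σ - b) + σ ^ 2 - (t - T) ^ 2) ≤ M) :
    ∀ σ ∈ Set.Icc 0 b, ‖f ((σ:ℂ) + T * I)‖ *
      Real.exp (r * L * (σ - b) + σ ^ 2) ≤ M := by
  intro σ hσ
  set g : ℂ → ℂ := fun s => f s * cexp (r * L * (s - b) + (s - T * I) ^ 2) with hg
  have hn : ∀ x t : ℝ, ‖g ((x:ℂ) + t * I)‖ = ‖f ((x:ℂ) + t * I)‖ *
      Real.exp (r * L * (x - b) + x ^ 2 - (t - T) ^ 2) := by
    intro x t
    simp only [hg, norm_mul, Complex.norm_exp]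
    congr 2
    simp [pow_two]
    ring
  have hle : T - h < T + h := by linarith
  have hcl : closure (Set.Ioo 0 b ×ℂ Set.Ioo (T - h) (T + h)) =
      Set.Icc 0 b ×ℂ Set.Icc (T - h) (T + h) := by
    rw [Complex.closure_reProdIm, closure_Ioo hb.ne, closure_Ioo hle.ne]
  have hdc : DiffContOnCl ℂ g (Set.Ioo 0 b ×ℂ Set.Ioo (T - h) (T + h)) := by
    refine ⟨hd.mul (by fun_prop), ?_⟩
    rw [hcl]
    exact hc.mul (by fun_prop)
  have hbd : Bornology.IsBounded (Set.Ioo 0 b ×ℂ Set.Ioo (T - h) (T + h)) :=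
    (Metric.isBounded_Ioo _ _).reProdIm (Metric.isBounded_Ioo _ _)
  have key := Complex.norm_le_of_forall_mem_frontier_norm_le (C := M) hbd hdc (by
    intro z hz
    rw [Complex.frontier_reProdIm, closure_Ioo hb.ne, closure_Ioo hle.ne,
      frontier_Ioo hb, frontier_Ioo hle] at hz
    have hz' : z = (z.re : ℂ) + z.im * I := (Complex.re_add_im z).symm
    rw [hz', hn]
    rcases hz with hz | hz
    · have h1 := hz.1
      have h2 := hz.2
      simp only [Set.mem_preimage, Set.mem_insert_iff, Set.mem_singleton_iff] at h1 h2
      exact hhor _ h1 _ h2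
    · have h1 := hz.1
      have h2 := hz.2
      simp only [Set.mem_preimage, Set.mem_insert_iff, Set.mem_singleton_iff] at h1 h2
      rcases h1 with h1 | h1
      · rw [h1]; exact hleft _ h2
      · rw [h1]; exact hright _ h2) (z := (σ:ℂ) + T * I) (by
        rw [hcl]
        constructor
        · simpa using hσ
        · simp [hh.le])
  rw [hn] at key
  simpa using key

theorem dcb_series (a lam : ℕ → ℝ) (f : ℂ → ℂ)
    (ha : ∀ n, 0 < a n) (hlam : ∀ n, 0 < lam n)
    (habs : ∀ s : ℂ, 1 < s.re → Summable fun n => a n * lam n ^ (-s.re))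
    (hf : ∀ s : ℂ, 1 < s.re → f s = ∑' n, (a n : ℂ) * ((lam n : ℂ) ^ (-s)))
    (b t : ℝ) (hb : 1 < b) : ‖f ((b:ℂ) + t * I)‖ ≤ ‖f (b:ℂ)‖ := by
  have hs : Summable fun n => a n * lam n ^ (-b) := by simpa using habs (b:ℂ) (by simpa using hb)
  have e1 : f (b:ℂ) = ((∑' n, a n * lam n ^ (-b) : ℝ) : ℂ) := by
    rw [hf _ (by simpa using hb), Complex.ofReal_tsum]
    congr 1; ext n
    rw [Complex.ofReal_mul, Complex.ofReal_cpow (hlam n).le, Complex.ofReal_neg]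
  have e2 : ∀ n, ‖(a n : ℂ) * ((lam n : ℂ) ^ (-((b:ℂ) + t * I)))‖ = a n * lam n ^ (-b) := by
    intro n
    rw [norm_mul, Complex.norm_cpow_eq_rpow_re_of_pos (hlam n)]
    simp [abs_of_pos (ha n)]
  rw [hf ((b:ℂ) + t * I) (by simpa using hb), e1, Complex.norm_real]
  refine (tsum_of_norm_bounded hs.hasSum (fun n => (e2 n).le)).trans (le_abs_self _)

set_option maxHeartbeats 2000000 in
/-- convexity bound. With `f(s) = Σ aₙ λₙ^{-s}` as in the context,
there is a constant `C > 0` such that for every `σ ∈ [0,1]` and every real `t` with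
`|t| ≥ 3`, `|f(σ+it)| ≤ C·|t|^{r(1-σ)}·log|t|`. -/
theorem dirichlet_convexity_bound
    (a lam : ℕ → ℝ) (f : ℂ → ℂ) (r C₀ t₀ ares : ℝ) (K : ℕ) (ρ : Fin K → ℝ)
    (ha : ∀ n, 0 < a n) (hlam : ∀ n, 0 < lam n)
    (hmono : StrictMono lam) (htop : Tendsto lam atTop atTop)
    (habs : ∀ s : ℂ, 1 < s.re → Summable fun n => a n * lam n ^ (-s.re))
    (hf : ∀ s : ℂ, 1 < s.re → f s = ∑' n, (a n : ℂ) * ((lam n : ℂ) ^ (-s)))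
    (hρ : ∀ j, ρ j ∈ Set.Ioo (0:ℝ) 1)
    (hholo : DifferentiableOn ℂ f
      ({s : ℂ | 0 < s.re} \ ({1} ∪ Set.range fun j => ((ρ j : ℝ) : ℂ))))
    (hares : 0 < ares)
    (hpole1 : Tendsto (fun s : ℂ => (s - 1) * f s) (nhdsWithin 1 {(1:ℂ)}ᶜ)
      (nhds (ares : ℂ)))
    (hord : ∀ j, ∃ (m : ℕ) (L : ℂ), Tendsto (fun s : ℂ => (s - (ρ j : ℂ)) ^ m * f s)
      (nhdsWithin ((ρ j : ℝ) : ℂ) {((ρ j : ℝ) : ℂ)}ᶜ) (nhds L))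
    (hcont : ContinuousOn f {s : ℂ | 0 ≤ s.re ∧ s ≠ 1 ∧ ∀ j, s ≠ ((ρ j : ℝ) : ℂ)})
    (hr : 1 ≤ r) (hC₀ : 0 < C₀) (ht₀ : 1 ≤ t₀)
    (hgrowth : ∀ σ t : ℝ, 0 ≤ σ → σ < 3/2 → t₀ ≤ |t| →
      ‖f (σ + t * Complex.I)‖ ≤ C₀ * |t| ^ r) :
    ∃ C : ℝ, 0 < C ∧ ∀ σ t : ℝ, 0 ≤ σ → σ ≤ 1 → 3 ≤ |t| →
      ‖f (σ + t * Complex.I)‖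
        ≤ C * |t| ^ (r * (1 - σ)) * Real.log |t| := by
  have hne : ∀ s : ℂ, s.im ≠ 0 → s ≠ 1 ∧ ∀ j, s ≠ ((ρ j : ℝ) : ℂ) := by
    intro s hs
    constructor
    · rintro rfl; simp at hs
    · rintro j rfl; simp at hs
  -- bound near the pole
  obtain ⟨δ, hδ, hδ1⟩ : ∃ δ > 0, ∀ b : ℝ, 1 < b → b < 1 + δ →
      (b - 1) * ‖f (b:ℂ)‖ ≤ ares + 1 := by
    have h1 := (hpole1.norm).eventually (gt_mem_nhds (show ‖(ares:ℂ)‖ < ares + 1 by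
      rw [Complex.norm_real, Real.norm_of_nonneg hares.le]; linarith))
    obtain ⟨δ, hδ, h2⟩ := Metric.mem_nhdsWithin_iff.1 h1
    refine ⟨δ, hδ, fun b hb hb' => ?_⟩
    have h3 := @h2 (b:ℂ) ⟨by
      rw [Metric.mem_ball, dist_eq_norm]
      rw [← Complex.ofReal_one, ← Complex.ofReal_sub, Complex.norm_real, Real.norm_of_nonneg] <;>
        linarith, by
      simp only [Set.mem_compl_iff, Set.mem_singleton_iff]
      intro h; have : b = 1 := by exact_mod_cast h
      linarith⟩
    simp only [Set.mem_ofPred_eq, norm_mul] at h3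
    rw [← Complex.ofReal_one, ← Complex.ofReal_sub, Complex.norm_real, Real.norm_of_nonneg (by linarith)] at h3
    exact h3.le
  -- threshold
  obtain ⟨T₀, hT₀a, hT₀b, hT₀c⟩ : ∃ T₀ : ℝ, 2 * t₀ ≤ T₀ ∧ 3 ≤ T₀ ∧
      ∀ T, T₀ ≤ T → 3 ≤ Real.log T ∧ 1 / Real.log T < δ := by
    refine ⟨max (max (2 * t₀) 3) (Real.exp (max 3 (1 / δ + 1))), ?_, ?_, ?_⟩
    · exact (le_max_left _ _).trans (le_max_left _ _)
    · exact (le_max_right _ _).trans (le_max_left _ _)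
    · intro T hT
      have h1 : Real.exp (max 3 (1 / δ + 1)) ≤ T := (le_max_right _ _).trans hT
      have h2 := (Real.le_log_iff_exp_le ((Real.exp_pos _).trans_le h1)).2 h1
      have h3 : 3 ≤ Real.log T := (le_max_left _ _).trans h2
      have h4 : 1 / δ + 1 ≤ Real.log T := (le_max_right _ _).trans h2
      refine ⟨h3, ?_⟩
      rw [div_lt_comm₀ (by linarith) hδ]
      linarith
  -- compact part
  obtain ⟨B, hB⟩ : ∃ B, ∀ σ t : ℝ, 0 ≤ σ → σ ≤ 1 → 3 ≤ |t| → |t| ≤ T₀ →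
      ‖f (σ + t * I)‖ ≤ B := by
    have hcomp : IsCompact (Set.Icc (0:ℝ) 1 ×ℂ (Set.Icc (-T₀) (-3) ∪ Set.Icc 3 T₀)) :=
      isCompact_Icc.reProdIm (isCompact_Icc.union isCompact_Icc)
    obtain ⟨B, hB⟩ := hcomp.exists_bound_of_continuousOn (f := f) (hcont.mono (by
      rintro s ⟨h1, h2⟩
      refine ⟨h1.1, hne s ?_⟩
      rcases h2 with h2 | h2
      · have := h2.2; intro h; linarith
      · have := h2.1; intro h; linarith))
    refine ⟨B, fun σ t h0 h1 h3 hT => hB _ ⟨by simp [h0, h1], ?_⟩⟩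
    have him : ((σ:ℂ) + t * I).im = t := by simp
    rw [Set.mem_preimage, him]
    rcases le_total 0 t with ht | ht
    · rw [abs_of_nonneg ht] at h3 hT; exact Or.inr ⟨h3, hT⟩
    · rw [abs_of_nonpos ht] at h3 hT; exact Or.inl ⟨by linarith, by linarith⟩
  set M₁ : ℝ := C₀ * (3/2) ^ r * Real.exp (2 + r ^ 2) + (ares + 1) * Real.exp 2 with hM₁
  have hM₁pos : 0 < M₁ := by positivity
  refine ⟨M₁ * Real.exp r + |B|, by positivity, fun σ t h0 h1 h3 => ?_⟩
  have hlog : 1 ≤ Real.log |t| := by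
    rw [Real.le_log_iff_exp_le (by linarith)]
    have := Real.exp_one_lt_d9; linarith
  have hpow : 1 ≤ |t| ^ (r * (1 - σ)) :=
    Real.one_le_rpow (by linarith) (mul_nonneg (by linarith) (by linarith))
  rcases le_total |t| T₀ with hT | hT
  · calc ‖f (σ + t * I)‖ ≤ B := hB σ t h0 h1 h3 hT
      _ ≤ |B| := le_abs_self _
      _ ≤ (M₁ * Real.exp r + |B|) * 1 * 1 := by
        have : 0 < M₁ * Real.exp r := by positivity
        linarith
      _ ≤ _ := by gcongr
  obtain ⟨hL3, hLδ⟩ := hT₀c _ hT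
  set L := Real.log |t| with hL
  have htpos : 0 < |t| := by linarith
  have hLpos : 0 < L := by linarith
  set b : ℝ := 1 + 1 / L with hbdef
  have hinv : 0 < 1 / L := by positivity
  have hb1 : 1 < b := by linarith
  have hb2 : b ≤ 4/3 := by
    have : 1 / L ≤ 1 / 3 := one_div_le_one_div_of_le (by norm_num) hL3
    linarith
  have hsq : ∀ x ∈ Set.Icc 0 b, x ^ 2 ≤ 2 := by
    intro x hx; have h1 := hx.1; have h2 := hx.2; nlinarith
  have habs' : ∀ y ∈ Set.Icc (t - |t|/2) (t + |t|/2), |t|/2 ≤ |y| ∧ |y| ≤ 3/2 * |t| := by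
    rintro y ⟨hy1, hy2⟩
    rcases le_total 0 t with ht | ht
    · rw [abs_of_nonneg ht] at *
      rw [abs_of_nonneg (by linarith)]; constructor <;> linarith
    · rw [abs_of_nonpos ht] at *
      rw [abs_of_nonpos (by linarith)]; constructor <;> linarith
  have him : ∀ y ∈ Set.Icc (t - |t|/2) (t + |t|/2), y ≠ 0 := by
    intro y hy h; have := (habs' y hy).1; rw [h, abs_zero] at this; linarith
  have hgr : ∀ x ∈ Set.Icc 0 b, ∀ y ∈ Set.Icc (t - |t|/2) (t + |t|/2),
      ‖f (x + y * I)‖ ≤ C₀ * (3/2) ^ r * Real.exp (r * L) := by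
    intro x hx y hy
    obtain ⟨h4, h5⟩ := habs' y hy
    calc _ ≤ C₀ * |y| ^ r := hgrowth x y hx.1 (by linarith [hx.2]) (by linarith)
      _ ≤ C₀ * (3/2 * |t|) ^ r := by gcongr
      _ = _ := by
        rw [Real.mul_rpow (by norm_num) htpos.le, Real.rpow_def_of_pos htpos, ← hL]
        ring_nf
  have hD : 0 < C₀ * (3/2 : ℝ) ^ r := by positivity
  have hM1 : C₀ * (3/2) ^ r * Real.exp (2 + r ^ 2) ≤ M₁ * L := by
    have : 0 < (ares + 1) * Real.exp 2 := by positivity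
    have : C₀ * (3/2) ^ r * Real.exp (2 + r ^ 2) ≤ M₁ := by rw [hM₁]; linarith
    nlinarith
  have key := dcb_rect f r b L (|t|/2) t (M₁ * L) (by linarith) (by linarith)
    (hholo.mono (by
      rintro s ⟨h4, h5⟩
      have := hne s (him _ ⟨h5.1.le, h5.2.le⟩)
      refine ⟨h4.1, ?_⟩
      rintro (h | ⟨j, hj⟩)
      · exact this.1 h
      · exact this.2 j hj.symm))
    (hcont.mono (by
      rintro s ⟨h4, h5⟩
      exact ⟨h4.1, hne s (him _ h5)⟩))
    (by
      intro y hy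
      calc _ ≤ (C₀ * (3/2) ^ r * Real.exp (r * L)) *
            Real.exp (r * L * (0 - b) + 0 ^ 2 - (y - t) ^ 2) := by
            gcongr; exact hgr 0 ⟨le_rfl, by linarith⟩ y hy
        _ = C₀ * (3/2) ^ r * Real.exp (r * L + (r * L * (0 - b) + 0 ^ 2 - (y - t) ^ 2)) := by
            rw [Real.exp_add (r * L)]; ring
        _ ≤ C₀ * (3/2) ^ r * Real.exp (2 + r ^ 2) := by
            refine mul_le_mul_of_nonneg_left (Real.exp_le_exp.2 ?_) hD.le
            have : 0 ≤ r * L * (b - 1) := by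
              have : 0 ≤ b - 1 := by linarith
              positivity
            nlinarith [sq_nonneg (y - t), sq_nonneg r]
        _ ≤ _ := hM1)
    (by
      intro y hy
      have h4 : ‖f ((b:ℂ) + y * I)‖ ≤ (ares + 1) * L := by
        refine (dcb_series a lam f ha hlam habs hf b y hb1).trans ?_
        have := hδ1 b hb1 (by linarith)
        have e : b - 1 = 1 / L := by rw [hbdef]; ring
        rw [e, one_div, inv_mul_le_iff₀ hLpos] at this
        linarith
      calc _ ≤ ((ares + 1) * L) * Real.exp 2 := by
            gcongr
            have := hsq b ⟨by linarith, le_rfl⟩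
            nlinarith [sq_nonneg (y - t)]
        _ ≤ _ := by
            rw [hM₁]
            have : 0 ≤ C₀ * (3/2) ^ r * Real.exp (2 + r ^ 2) * L := by positivity
            linarith)
    (by
      intro x hx y hy
      have hy' : y ∈ Set.Icc (t - |t|/2) (t + |t|/2) := by
        rcases hy with rfl | rfl <;> constructor <;> linarith
      have hyt : (y - t) ^ 2 = |t| ^ 2 / 4 := by
        rcases hy with rfl | rfl <;> ring
      calc _ ≤ (C₀ * (3/2) ^ r * Real.exp (r * L)) *
            Real.exp (r * L * (x - b) + x ^ 2 - (y - t) ^ 2) := by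
            gcongr; exact hgr x hx y hy'
        _ = C₀ * (3/2) ^ r * Real.exp (r * L + (r * L * (x - b) + x ^ 2 - (y - t) ^ 2)) := by
            rw [Real.exp_add (r * L)]; ring
        _ ≤ C₀ * (3/2) ^ r * Real.exp (2 + r ^ 2) := by
            refine mul_le_mul_of_nonneg_left (Real.exp_le_exp.2 ?_) hD.le
            have h5 : 0 ≤ r * L * (b - x) := by
              have : 0 ≤ b - x := by linarith [hx.2]
              positivity
            have h6 := hsq x hx
            have h7 : L ≤ |t| := (Real.log_le_sub_one_of_pos htpos).trans (by linarith)
            have h8 : r * L ≤ r * |t| := by gcongr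
            rw [hyt]
            nlinarith [sq_nonneg (|t| / 2 - r)]
        _ ≤ _ := hM1)
    σ ⟨h0, by linarith⟩
  have e1 : |t| ^ (r * (1 - σ)) * Real.exp r = Real.exp (-(r * L * (σ - b))) := by
    rw [Real.rpow_def_of_pos htpos, ← Real.exp_add, ← hL, hbdef]
    congr 1
    field_simp
    ring
  have e2 : ‖f (σ + t * I)‖ * Real.exp (r * L * (σ - b)) ≤ M₁ * L := by
    refine le_trans ?_ key
    gcongr
    nlinarith [sq_nonneg σ]
  have e3 : ‖f (σ + t * I)‖ ≤ M₁ * L * (|t| ^ (r * (1 - σ)) * Real.exp r) := by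
    rw [e1, Real.exp_neg, ← div_eq_mul_inv, le_div_iff₀ (Real.exp_pos _)]
    exact e2
  have e4 : 0 ≤ |B| * |t| ^ (r * (1 - σ)) * L := by positivity
  calc _ ≤ _ := e3
    _ ≤ _ := by nlinarith
end

section
/- Let ι be an index set, w : ι → ℝ nonnegative weights, and γ : ι → ℝ such that for every T > 0 the set { i : |γ(i)| ≤ T } is finite. Define F(T) = Σ_{i : |γ(i)| ≤ T} (T − |γ(i)|)·w(i). Suppose there are real constants c, B, C₀, K with | F(T) − ( c·T²·log T + B·T² + C₀·T ) | ≤ K·log T for all T ≥ 2. Then there exists a constant K' such that | Σ_{i : |γ(i)| ≤ T} w(i) − ( 2c·T·log T + (2B + c)·T ) | ≤ K'·log T for all T ≥ 3. -/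
lemma aux_summable {ι : Type*} (γ : ι → ℝ) (T : ℝ) (h : {i | |γ i| ≤ T}.Finite) (f : ι → ℝ) :
    Summable (fun i => if |γ i| ≤ T then f i else 0) := by
  apply summable_of_finite_support
  apply h.subset
  intro i hi
  by_contra hc
  apply hi
  have : ¬ (|γ i| ≤ T) := hc
  simp [this]

lemma aux_log (a : ℝ) (ha : 0 < a) :
    1 ≤ (a + 1) * (Real.log (a + 1) - Real.log a) ∧
    a * (Real.log (a + 1) - Real.log a) ≤ 1 := by
  have h1 : 0 < (a + 1) / a := by positivity
  have e : Real.log ((a + 1) / a) = Real.log (a + 1) - Real.log a :=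
    Real.log_div (by positivity) (by positivity)
  have h2 := Real.one_sub_inv_le_log_of_pos h1
  have h3 := Real.log_le_sub_one_of_pos h1
  rw [e] at h2 h3
  constructor
  · calc (1 : ℝ) = (a + 1) * (1 - ((a + 1) / a)⁻¹) := by field_simp; ring
      _ ≤ _ := by gcongr
  · calc _ ≤ a * ((a + 1) / a - 1) := by gcongr
      _ = 1 := by field_simp; ring


/-- Let `w : ι → ℝ` be nonnegative weights and `γ : ι → ℝ` with
`{i : |γ i| ≤ T}` finite for all `T > 0`, and let
`F(T) = Σ_{|γ i| ≤ T} (T - |γ i|)·w i`. If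
`|F(T) - (c·T²·log T + B·T² + C₀·T)| ≤ K·log T` for all `T ≥ 2`, then there is `K'` with
`|Σ_{|γ i| ≤ T} w i - (2c·T·log T + (2B + c)·T)| ≤ K'·log T` for all `T ≥ 3`. -/
theorem sharp_count_from_smoothed_count {ι : Type*} (w γ : ι → ℝ)
    (hw : ∀ i, 0 ≤ w i)
    (hfin : ∀ T : ℝ, 0 < T → {i | |γ i| ≤ T}.Finite)
    (c B C₀ K : ℝ)
    (hF : ∀ T : ℝ, 2 ≤ T →
      |(∑' i, if |γ i| ≤ T then (T - |γ i|) * w i else 0)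
          - (c * T^2 * Real.log T + B * T^2 + C₀ * T)| ≤ K * Real.log T) :
    ∃ K' : ℝ, ∀ T : ℝ, 3 ≤ T →
      |(∑' i, if |γ i| ≤ T then w i else 0)
          - (2 * c * T * Real.log T + (2 * B + c) * T)| ≤ K' * Real.log T := by
  have hup : ∀ T : ℝ, 0 < T → (∑' i, if |γ i| ≤ T then w i else 0) ≤
      (∑' i, if |γ i| ≤ T + 1 then (T + 1 - |γ i|) * w i else 0)
      - (∑' i, if |γ i| ≤ T then (T - |γ i|) * w i else 0) := by
    intro T hT
    have s1 := aux_summable γ T (hfin T hT) w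
    have s2 := aux_summable γ T (hfin T hT) (fun i => (T - |γ i|) * w i)
    have s3 := aux_summable γ (T + 1) (hfin _ (by linarith)) (fun i => (T + 1 - |γ i|) * w i)
    rw [← s3.tsum_sub s2]
    refine s1.tsum_le_tsum (fun i => ?_) (s3.sub s2)
    have := hw i
    split_ifs <;> nlinarith
  have hlo : ∀ T : ℝ, 0 < T → 
      (∑' i, if |γ i| ≤ T + 1 then (T + 1 - |γ i|) * w i else 0)
      - (∑' i, if |γ i| ≤ T then (T - |γ i|) * w i else 0) ≤
      (∑' i, if |γ i| ≤ T + 1 then w i else 0) := by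
    intro T hT
    have s1 := aux_summable γ (T + 1) (hfin _ (by linarith)) w
    have s2 := aux_summable γ T (hfin T hT) (fun i => (T - |γ i|) * w i)
    have s3 := aux_summable γ (T + 1) (hfin _ (by linarith)) (fun i => (T + 1 - |γ i|) * w i)
    rw [← s3.tsum_sub s2]
    refine (s3.sub s2).tsum_le_tsum (fun i => ?_) s1
    have := hw i
    split_ifs <;> nlinarith
  have hcx : ∀ x M : ℝ, |x| ≤ M → |c * x| ≤ |c| * M := fun x M h => by
    rw [abs_mul]; gcongr
  refine ⟨4 * |c| + |B| + |C₀| + 3 * |K|, fun T hT => ?_⟩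
  have hL : 1 ≤ Real.log T := by
    rw [Real.le_log_iff_exp_le (by linarith)]
    linarith [Real.exp_one_lt_d9]
  have hU := hup T (by linarith)
  have hD := hlo (T - 1) (by linarith)
  obtain ⟨a1, a2⟩ := aux_log T (by linarith)
  obtain ⟨b1, b2⟩ := aux_log (T - 1) (by linarith)
  have f1 := hF (T + 1) (by linarith)
  have f2 := hF T (by linarith)
  have f3 := hF (T - 1) (by linarith)
  rw [sub_add_cancel] at hD b1 b2
  set L := Real.log T
  set d := Real.log (T + 1) - L with hd
  set e := L - Real.log (T - 1) with he
  have hd0 : 0 ≤ d := by nlinarith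
  have hd1 : d ≤ 1 := by nlinarith
  have he0 : 0 ≤ e := by nlinarith
  rw [show Real.log (T + 1) = L + d by rw [hd]; ring] at f1
  rw [show Real.log (T - 1) = L - e by rw [he]; ring] at f3
  have c1 := hcx (L + (T + 1) ^ 2 * d - T) (4 * L) (by
    rw [abs_le]; constructor <;> nlinarith)
  have c2 := hcx (- L + (T - 1) ^ 2 * e - T) (4 * L) (by
    rw [abs_le]; constructor <;> nlinarith)
  have kk := le_abs_self K
  have k1 : K * (L + d) ≤ |K| * (2 * L) :=
    mul_le_mul kk (by linarith) (by linarith) (abs_nonneg _)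
  have k2 : K * L ≤ |K| * L := by gcongr
  have k3 : K * (L - e) ≤ |K| * L := by
    have : 0 ≤ L - e := by rw [he, sub_sub_cancel]; exact Real.log_nonneg (by linarith)
    exact mul_le_mul kk (by linarith) this (abs_nonneg _)
  have hB : |B| ≤ |B| * L := le_mul_of_one_le_right (abs_nonneg _) hL
  have hC : |C₀| ≤ |C₀| * L := le_mul_of_one_le_right (abs_nonneg _) hL
  have k0 : 0 ≤ |K| * L := by positivity
  have B1 := neg_abs_le B
  have B2 := le_abs_self B
  have C1 := neg_abs_le C₀
  have C2 := le_abs_self C₀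
  rw [abs_le] at f1 f2 f3 c1 c2 ⊢
  obtain ⟨f1, f1'⟩ := f1
  obtain ⟨f2, f2'⟩ := f2
  obtain ⟨f3, f3'⟩ := f3
  obtain ⟨c1, c1'⟩ := c1
  obtain ⟨c2, c2'⟩ := c2
  constructor
  · linarith
  · linarith
end
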